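/- arXiv:2506.07926 — 2 statements merged into one kernel-verified Lean document; each statement's English description precedes it below -/
import Mathlib

section
/- Let θ ∈ (0,1) and let α, β, γ > 0 be real numbers. Then for every complex number s with Re(s) ≥ 0, the characteristic function of the fractional harmonic oscillator does not vanish: s² + α s + β s^θ + γ ≠ 0, where s^θ denotes the principal complex power (with 0^θ = 0). -/
/-- Powers with real exponent in `[-1, 1]` map the closed right half-plane into itself. -/
theorem Complex.cpow_ofReal_re_nonneg {s : ℂ} {y : ℝ} (hs : 0 ≤ s.re) (hy : |y| ≤ 1) :
    0 ≤ (s ^ (y : ℂ)).re := by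
  rw [Complex.cpow_ofReal_re]
  have harg : |s.arg| ≤ Real.pi / 2 := Complex.abs_arg_le_pi_div_two_iff.mpr hs
  have hmul : |s.arg * y| ≤ Real.pi / 2 := by
    rw [abs_mul]
    exact (mul_le_of_le_one_right (abs_nonneg _) hy).trans harg
  exact mul_nonneg (Real.rpow_nonneg (norm_nonneg s) y)
    (Real.cos_nonneg_of_mem_Icc (abs_le.mp hmul))

/-- **Stability of the fractional harmonic oscillator.** For `θ ∈ (0,1)` and
`α, β, γ > 0`, the characteristic function `s² + α s + β s^θ + γ` of the
fractional harmonic oscillator has no zero in the closed right half-plane,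
where `s^θ` is the principal complex power (with `0^θ = 0`). -/
theorem fractional_oscillator_stable (θ α β γ : ℝ)
    (hθ : θ ∈ Set.Ioo (0 : ℝ) 1) (hα : 0 < α) (hβ : 0 < β) (hγ : 0 < γ) :
    ∀ s : ℂ, 0 ≤ s.re →
      s ^ 2 + (α : ℂ) * s + (β : ℂ) * s ^ (θ : ℂ) + (γ : ℂ) ≠ 0 := by
  intro s hs
  obtain ⟨hθ₀, hθ₁⟩ := hθ
  rcases eq_or_ne s 0 with rfl | hs₀
  · have hθ_ne : (θ : ℂ) ≠ 0 := by exact_mod_cast hθ₀.ne'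
    simpa [Complex.zero_cpow hθ_ne] using hγ.ne'
  have hpow : s ^ (θ : ℂ) = s ^ ((θ - 1 : ℝ) : ℂ) * s := by
    rw [Complex.ofReal_sub, Complex.ofReal_one, Complex.cpow_sub _ _ hs₀, Complex.cpow_one,
      div_mul_cancel₀ _ hs₀]
  have hfactor : s ^ 2 + (α : ℂ) * s + (β : ℂ) * s ^ (θ : ℂ) + (γ : ℂ) =
      s * (s + (α : ℂ) + (β : ℂ) * s ^ ((θ - 1 : ℝ) : ℂ) + (γ : ℂ) * s⁻¹) := by
    rw [hpow]
    field_simp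
  rw [hfactor]
  refine mul_ne_zero hs₀ fun h => ?_
  have hre := congrArg Complex.re h
  simp only [Complex.add_re, Complex.re_ofReal_mul, Complex.ofReal_re, Complex.zero_re] at hre
  have hpow_re : 0 ≤ β * (s ^ ((θ - 1 : ℝ) : ℂ)).re :=
    mul_nonneg hβ.le (Complex.cpow_ofReal_re_nonneg hs (abs_le.mpr ⟨by linarith, by linarith⟩))
  have hinv_re : 0 ≤ γ * (s⁻¹).re := by
    rw [Complex.inv_re]
    exact mul_nonneg hγ.le (div_nonneg hs (Complex.normSq_nonneg s))
  linarith
end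

section
/- There exist a real number θ ∈ [0.8169, 0.8170] and a real number ω > 0 such that (iω)² − (iω) + 1.2 (iω)^θ + 4 = 0, where (iω)^θ denotes the principal complex power; that is, for the parameter values α = −1, β = 1.2, γ = 4, the characteristic equation s² + α s + β s^θ + γ = 0 of the fractional harmonic oscillator admits a purely imaginary root for some fractional order θ in this interval. -/
open Real in
/-- If the base `b` is positive and `ω = b ^ (1 - θ)⁻¹`, then `ω = b * ω ^ θ`. -/
lemma rpow_inv_one_sub_eq_mul_rpow {b θ : ℝ} (hb : 0 < b) (hθ : θ < 1) :
    b ^ (1 - θ)⁻¹ = b * (b ^ (1 - θ)⁻¹) ^ θ := by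
  have h : 1 - θ ≠ 0 := by linarith
  rw [← rpow_mul hb.le]
  nth_rewrite 2 [← rpow_one b]
  rw [← rpow_add hb]
  congr 1
  field_simp
  ring

open Real in
/-- The imaginary and real parts of the characteristic equation at `s = iω` suffice. -/
lemma characteristic_eq_zero_of_parts {β γ θ ω : ℝ} (hω : 0 < ω)
    (him : ω = β * ω ^ θ * sin (π * θ / 2))
    (hre : γ - ω ^ 2 + β * ω ^ θ * cos (π * θ / 2) = 0) :
    (Complex.I * ω) ^ 2 - Complex.I * ω + (β : ℂ) * (Complex.I * ω) ^ (θ : ℂ) + γ = 0 := by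
  have hpow : (Complex.I * ω) ^ (θ : ℂ) =
      ((ω ^ θ : ℝ) : ℂ) * (cos (π * θ / 2) + sin (π * θ / 2) * Complex.I) := by
    have hω' : (ω : ℂ) ≠ 0 := Complex.ofReal_ne_zero.mpr hω.ne'
    rw [Complex.cpow_def_of_ne_zero (mul_ne_zero Complex.I_ne_zero hω'),
      Complex.log_mul_ofReal ω hω _ Complex.I_ne_zero, add_mul, Complex.exp_add,
      Complex.log_I, rpow_def_of_pos hω, Complex.ofReal_exp, Complex.ofReal_mul,
      Complex.ofReal_cos, Complex.ofReal_sin, ← Complex.exp_mul_I]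
    congr 2
    push_cast
    ring
  rw [hpow]
  have him' := congrArg (fun x : ℝ => (x : ℂ)) him
  have hre' := congrArg (fun x : ℝ => (x : ℂ)) hre
  simp only [Complex.ofReal_mul, Complex.ofReal_add, Complex.ofReal_sub, Complex.ofReal_pow,
    Complex.ofReal_zero] at him' hre'
  linear_combination hre' - Complex.I * him' + (ω : ℂ) ^ 2 * Complex.I_sq

open Real in
lemma sin_le_sub_cube_add {x : ℝ} (h0 : 0 ≤ x) (h1 : x ≤ 1) :
    sin x ≤ x - x ^ 3 / 6 + x ^ 5 / 100 := by
  have h := sin_bound (x := x) (by rwa [abs_of_nonneg h0])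
  rw [abs_of_nonneg h0] at h
  linarith [(abs_le.mp h).2]

open Real in
lemma cos_eq_one_sub_two_mul_sin_half_sq (x : ℝ) : cos x = 1 - 2 * sin (x / 2) ^ 2 := by
  have h := cos_two_mul (x / 2)
  rw [mul_div_cancel₀ x two_ne_zero] at h
  linarith [sin_sq_add_cos_sq (x / 2)]

open Real in
/-- The frequency forced by the imaginary part of the characteristic equation. -/
noncomputable def criticalFrequency (θ : ℝ) : ℝ :=
  (1.2 * sin (π * θ / 2)) ^ (1 - θ)⁻¹

/-- The real part of the characteristic equation at the critical frequency, multiplied by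
`sin (π * θ / 2)`. -/
noncomputable def criticalRealPart (θ : ℝ) : ℝ :=
  (4 - criticalFrequency θ ^ 2) * Real.sin (Real.pi * θ / 2)
    + criticalFrequency θ * Real.cos (Real.pi * θ / 2)

open Real in
lemma sin_pi_mul_div_two_pos {θ : ℝ} (h0 : 0 < θ) (h1 : θ < 1) : 0 < sin (π * θ / 2) :=
  sin_pos_of_pos_of_lt_pi (by positivity) (by nlinarith [pi_pos])

open Real in
lemma continuousOn_criticalRealPart : ContinuousOn criticalRealPart (Set.Ioo 0 1) := by
  have hω : ContinuousOn criticalFrequency (Set.Ioo 0 1) := by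
    refine ContinuousOn.rpow (by fun_prop) ?_ fun θ hθ => Or.inl ?_
    · exact ContinuousOn.inv₀ (by fun_prop) fun θ hθ => by linarith [hθ.2]
    · have := sin_pi_mul_div_two_pos hθ.1 hθ.2
      positivity
  unfold criticalRealPart
  fun_prop

open Real in
lemma criticalFrequency_pos {θ : ℝ} (h0 : 0 < θ) (h1 : θ < 1) : 0 < criticalFrequency θ := by
  have := sin_pi_mul_div_two_pos h0 h1
  unfold criticalFrequency
  positivity

open Real in
lemma criticalRealPart_lower_nonneg : 0 ≤ criticalRealPart 0.8169 := by
  have hπ := pi_gt_d20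
  have hπ' := pi_lt_d20
  have hsin : sin (π * 0.8169 / 2) = cos (π * 0.09155) := by
    rw [← sin_pi_div_two_sub]; congr 1; ring
  have hcos : cos (π * 0.8169 / 2) = sin (π * 0.09155) := by
    rw [← cos_pi_div_two_sub]; congr 1; ring
  have hc : cos (π * 0.09155) ≤ 0.958928 := by
    have hmono : cos (π * 0.09155) ≤ cos 0.2876128 :=
      cos_le_cos_of_nonneg_of_le_pi (by norm_num) (by linarith) (by linarith)
    have hs := sin_ge_sub_cube (x := 0.2876128 / 2) (by norm_num)
    rw [cos_eq_one_sub_two_mul_sin_half_sq 0.2876128] at hmono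
    norm_num at hs hmono ⊢
    nlinarith
  have hs : 0.2836 ≤ sin (π * 0.09155) := by
    have hmono : sin 0.2876128 ≤ sin (π * 0.09155) :=
      sin_le_sin_of_le_of_le_pi_div_two (by linarith) (by linarith) (by linarith)
    have hs := sin_ge_sub_cube (x := 0.2876128) (by norm_num)
    norm_num at hs hmono ⊢
    linarith
  have hω := criticalFrequency_pos (θ := 0.8169) (by norm_num) (by norm_num)
  have hpos := sin_pi_mul_div_two_pos (θ := 0.8169) (by norm_num) (by norm_num)
  have hle : criticalFrequency 0.8169 ≤ 2.153 := by
    unfold criticalFrequency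
    rw [rpow_inv_le_iff_of_pos (by positivity) (by norm_num) (by norm_num)]
    calc 1.2 * sin (π * 0.8169 / 2) ≤ 1.1507136 := by rw [hsin]; linarith
      _ ≤ (2.153 : ℝ) ^ (13 / 71 : ℝ) := by
        rw [div_eq_mul_inv, rpow_mul (by norm_num),
          le_rpow_inv_iff_of_pos (by norm_num) (by positivity) (by norm_num)]
        norm_cast
        norm_num
      _ ≤ _ := rpow_le_rpow_of_exponent_le (by norm_num) (by norm_num)
  unfold criticalRealPart
  rw [hsin] at hpos ⊢
  rw [hcos]
  generalize criticalFrequency 0.8169 = ω at *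
  generalize cos (π * 0.09155) = c at *
  have h1 : ω * (0.2957 * c) ≤ ω * sin (π * 0.09155) :=
    mul_le_mul_of_nonneg_left (by linarith) hω.le
  have h2 : 0 ≤ 4 - ω ^ 2 + 0.2957 * ω := by nlinarith
  nlinarith

open Real in
lemma criticalRealPart_upper_nonpos : criticalRealPart 0.8170 ≤ 0 := by
  have hπ := pi_gt_d20
  have hπ' := pi_lt_d20
  have hsin : sin (π * 0.8170 / 2) = cos (π * 0.0915) := by
    rw [← sin_pi_div_two_sub]; congr 1; ring
  have hcos : cos (π * 0.8170 / 2) = sin (π * 0.0915) := by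
    rw [← cos_pi_div_two_sub]; congr 1; ring
  have hc : 0.95896 ≤ cos (π * 0.0915) := by
    have hmono : cos 0.2874558 ≤ cos (π * 0.0915) :=
      cos_le_cos_of_nonneg_of_le_pi (by linarith) (by linarith) (by linarith)
    have hs := sin_le_sub_cube_add (x := 0.2874558 / 2) (by norm_num) (by norm_num)
    have hs0 : 0 ≤ sin (0.2874558 / 2) :=
      sin_nonneg_of_nonneg_of_le_pi (by norm_num) (by linarith)
    rw [cos_eq_one_sub_two_mul_sin_half_sq 0.2874558] at hmono
    norm_num at hs hs0 hmono ⊢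
    nlinarith
  have hs : sin (π * 0.0915) ≤ 0.28355 := by
    have hmono : sin (π * 0.0915) ≤ sin 0.2874558 :=
      sin_le_sin_of_le_of_le_pi_div_two (by linarith) (by linarith) (by linarith)
    have hs := sin_le_sub_cube_add (x := 0.2874558) (by norm_num) (by norm_num)
    norm_num at hs hmono ⊢
    linarith
  have hω := criticalFrequency_pos (θ := 0.8170) (by norm_num) (by norm_num)
  have hpos := sin_pi_mul_div_two_pos (θ := 0.8170) (by norm_num) (by norm_num)
  have hle : 2.1535 ≤ criticalFrequency 0.8170 := by
    unfold criticalFrequency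
    rw [le_rpow_inv_iff_of_pos (by norm_num) (by positivity) (by norm_num)]
    calc (2.1535 : ℝ) ^ (1 - 0.8170 : ℝ) ≤ (2.1535 : ℝ) ^ (28 / 153 : ℝ) :=
          rpow_le_rpow_of_exponent_le (by norm_num) (by norm_num)
      _ ≤ 1.150752 := by
        rw [div_eq_mul_inv, rpow_mul (by norm_num),
          rpow_inv_le_iff_of_pos (by positivity) (by norm_num) (by norm_num)]
        norm_cast
        norm_num
      _ ≤ 1.2 * sin (π * 0.8170 / 2) := by rw [hsin]; linarith
  unfold criticalRealPart
  rw [hsin] at hpos ⊢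
  rw [hcos]
  generalize criticalFrequency 0.8170 = ω at *
  generalize cos (π * 0.0915) = c at *
  have h1 : ω * sin (π * 0.0915) ≤ ω * (0.2957 * c) :=
    mul_le_mul_of_nonneg_left (by linarith) hω.le
  have h2 : 4 - ω ^ 2 + 0.2957 * ω ≤ 0 := by nlinarith
  nlinarith


/-- **Critical order of the fractional harmonic oscillator.** For the parameter
values `α = −1`, `β = 1.2`, `γ = 4`, there is a fractional order
`θ ∈ [0.8169, 0.8170]` and a frequency `ω > 0` such that the characteristic
equation `s² + α s + β s^θ + γ = 0` has the purely imaginary root `s = iω`,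
where `s^θ` is the principal complex power. -/
theorem fractional_oscillator_critical_order :
    ∃ θ ∈ Set.Icc (0.8169 : ℝ) 0.8170, ∃ ω : ℝ, 0 < ω ∧
      (Complex.I * ω) ^ 2 - Complex.I * ω
        + (1.2 : ℂ) * (Complex.I * ω) ^ (θ : ℂ) + 4 = 0 := by
  have hcont : ContinuousOn criticalRealPart (Set.Icc 0.8169 0.8170) :=
    continuousOn_criticalRealPart.mono
      (Set.Icc_subset_Ioo (by norm_num) (by norm_num))
  obtain ⟨θ, hθ, hzero⟩ := intermediate_value_Icc' (by norm_num) hcont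
    ⟨criticalRealPart_upper_nonpos, criticalRealPart_lower_nonneg⟩
  have h0 : 0 < θ := by linarith [hθ.1]
  have h1 : θ < 1 := by linarith [hθ.2]
  have hs := sin_pi_mul_div_two_pos h0 h1
  have hω := criticalFrequency_pos h0 h1
  have him : criticalFrequency θ =
      1.2 * Real.sin (Real.pi * θ / 2) * criticalFrequency θ ^ θ :=
    rpow_inv_one_sub_eq_mul_rpow (by positivity) h1
  have hre : 4 - criticalFrequency θ ^ 2
      + 1.2 * criticalFrequency θ ^ θ * Real.cos (Real.pi * θ / 2) = 0 := by
    refine (mul_eq_zero.mp ?_).resolve_left hs.ne'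
    unfold criticalRealPart at hzero
    linear_combination hzero - Real.cos (Real.pi * θ / 2) * him
  refine ⟨θ, hθ, criticalFrequency θ, hω, ?_⟩
  have h := characteristic_eq_zero_of_parts hω (by linear_combination him) hre
  push_cast at h
  exact h
end
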